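/- For every r(z) ∈ g^o_{N+1,+}, one has [r̂^o, L^{η,A}_{−1}] = (1/2) tr(r_1) · Id as linear operators on ℂ[ε, ε^{−1}][t^α_a : 1 ≤ α ≤ N+1, a ≥ 0], where tr(r_1) is the trace of the matrix r_1. -/

import Mathlib

noncomputable section

/-- The coefficient ring `ℂ[ε, ε^{−1}]` of Laurent polynomials; `ε = T 1`. -/
abbrev Kε := LaurentPolynomial ℂ

/-- The polynomial algebra `ℂ[ε, ε^{−1}][t^α_a : 1 ≤ α ≤ N+1, a ≥ 0]`. -/
abbrev Wt (N : ℕ) := MvPolynomial (Fin (N + 1) × ℕ) Kε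

/-- The shifted variable `q^α_a := t^α_a − A^α δ_{a,1}`. -/
def qv (N : ℕ) (A : Fin (N + 1) → ℂ) (v : Fin (N + 1) × ℕ) : Wt N :=
  MvPolynomial.X v - MvPolynomial.C (LaurentPolynomial.C (if v.2 = 1 then A v.1 else 0))

/-- The operator `L^{η,A}_{−1} = (ε^{−2}/2) η_{αβ} q^α_0 q^β_0 + ε^{−1} q^{N+1}_0
+ Σ_{d≥1} q^α_d ∂/∂q^α_{d−1}`. -/
def Lm1 (N : ℕ) (η : Matrix (Fin N) (Fin N) ℂ) (A : Fin (N + 1) → ℂ) (P : Wt N) : Wt N :=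
  ((LaurentPolynomial.T (-2) : Kε) • ((1 / 2 : ℂ) •
      (∑ α : Fin N, ∑ β : Fin N,
        η α β • (qv N A (α.castSucc, 0) * qv N A (β.castSucc, 0))))) * P +
  ((LaurentPolynomial.T (-1) : Kε) • qv N A (Fin.last N, 0)) * P +
  ∑ᶠ d : ℕ, ∑ α : Fin (N + 1), qv N A (α, d + 1) * MvPolynomial.pderiv (α, d) P

/-- Membership in `g^o_{N+1,+}`: `r(z) = Σ_{i≥1} r_i z^i` (encoded by `i ↦ r_i`, with `r_0 = 0`),
`(r_i)^α_{N+1} = 0` for all `α`, and `η^{αμ}(r_i)^ν_μ η_{νβ} = (−1)^{i+1}(r_i)^α_β` for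
`α, β ≤ N`. -/
def memGoPlus (N : ℕ) (η : Matrix (Fin N) (Fin N) ℂ)
    (r : ℕ → Matrix (Fin (N + 1)) (Fin (N + 1)) ℂ) : Prop :=
  r 0 = 0 ∧
  (∀ (i : ℕ) (α : Fin (N + 1)), r i α (Fin.last N) = 0) ∧
  (∀ i : ℕ, 1 ≤ i → ∀ α β : Fin N,
    (∑ μ : Fin N, ∑ ν : Fin N, η⁻¹ α μ * r i ν.castSucc μ.castSucc * η ν β) =
      (-1 : ℂ) ^ (i + 1) * r i α.castSucc β.castSucc)

/-- `(r_i)^{N+1,α} := (r_i)^{N+1}_μ η^{μα}` for `α ≤ N`. -/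
def rTop (N : ℕ) (η : Matrix (Fin N) (Fin N) ℂ)
    (r : ℕ → Matrix (Fin (N + 1)) (Fin (N + 1)) ℂ) (i : ℕ) (α : Fin N) : ℂ :=
  ∑ μ : Fin N, r i (Fin.last N) μ.castSucc * η⁻¹ μ α

/-- The raised-index coefficients `(r_i)^{αβ}`. -/
def rUp (N : ℕ) (η : Matrix (Fin N) (Fin N) ℂ)
    (r : ℕ → Matrix (Fin (N + 1)) (Fin (N + 1)) ℂ) (i : ℕ) (α β : Fin (N + 1)) : ℂ :=
  if hβ : (β : ℕ) < N then ∑ μ : Fin N, r i α μ.castSucc * η⁻¹ μ ⟨(β : ℕ), hβ⟩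
  else if hα : (α : ℕ) < N then (-1 : ℂ) ^ (i + 1) * rTop N η r i ⟨(α : ℕ), hα⟩
  else 0

/-- The operator `r̂^o` (with `q^α_a = t^α_a − A^α δ_{a,1}`); the sums over `i ≥ 1` are
reindexed by `i+1`. -/
def hatRo (N : ℕ) (η : Matrix (Fin N) (Fin N) ℂ) (A : Fin (N + 1) → ℂ)
    (r : ℕ → Matrix (Fin (N + 1)) (Fin (N + 1)) ℂ) (P : Wt N) : Wt N :=
  -(∑ᶠ i : ℕ, ∑ᶠ j : ℕ, ∑ μ : Fin (N + 1), ∑ ν : Fin (N + 1),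
      r (i + 1) μ ν • (qv N A (ν, j) * MvPolynomial.pderiv (μ, i + 1 + j) P))
  + (LaurentPolynomial.T 1 : Kε) •
      (∑ᶠ i : ℕ, ∑ ν : Fin N,
        ((-1 : ℂ) ^ (i + 1) * rTop N η r (i + 1) ν) • MvPolynomial.pderiv (ν.castSucc, i + 1) P)
  + (1 / 2 : ℂ) • ((LaurentPolynomial.T 2 : Kε) •
      (∑ᶠ i : ℕ, ∑ᶠ j : ℕ, ∑ α : Fin (N + 1), ∑ β : Fin (N + 1),
        ((-1 : ℂ) ^ j * rUp N η r (i + j + 1) α β) •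
          MvPolynomial.pderiv (α, i) (MvPolynomial.pderiv (β, j) P)))

open MvPolynomial Finset

theorem finsum_nat_eq_sum_range {M : Type*} [AddCommMonoid M] {f : ℕ → M} {n : ℕ}
    (h : ∀ i, n ≤ i → f i = 0) : ∑ᶠ i, f i = ∑ i ∈ range n, f i := by
  refine finsum_eq_sum_of_support_subset f fun i hi => ?_
  by_contra hc
  exact hi (h i (by simpa using hc))

theorem finsum_finsum_nat_eq_sum_range {M : Type*} [AddCommMonoid M] {f : ℕ → ℕ → M} {n : ℕ}
    (h : ∀ i j, n ≤ i ∨ n ≤ j → f i j = 0) :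
    ∑ᶠ i, ∑ᶠ j, f i j = ∑ i ∈ range n, ∑ j ∈ range n, f i j := by
  rw [finsum_nat_eq_sum_range (n := n)]
  · exact sum_congr rfl fun i _ => finsum_nat_eq_sum_range fun j hj => h i j (.inr hj)
  · intro i hi
    simp [h i _ (.inl hi)]

theorem MvPolynomial.exists_forall_mem_vars_snd_lt {σ R : Type*} [CommSemiring R]
    (P : MvPolynomial (σ × ℕ) R) : ∃ n, ∀ v ∈ P.vars, v.2 < n :=
  ⟨P.vars.sup Prod.snd + 1, fun _ hv => Nat.lt_succ_of_le (le_sup (f := Prod.snd) hv)⟩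

theorem Derivation.finset_sum_apply {R A M ι : Type*} [CommSemiring R] [CommSemiring A]
    [AddCommMonoid M] [Algebra R A] [Module A M] [Module R M] (s : Finset ι)
    (D : ι → Derivation R A M) (a : A) : (∑ i ∈ s, D i) a = ∑ i ∈ s, D i a := by
  classical
  induction s using Finset.induction_on with
  | empty => simp
  | insert i s hi ih => rw [sum_insert hi, sum_insert hi, Derivation.add_apply, ih]

theorem MvPolynomial.pderiv_comm {σ R : Type*} [CommRing R] (v w : σ) (P : MvPolynomial σ R) :
    pderiv v (pderiv w P) = pderiv w (pderiv v P) := by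
  classical
  have h : ⁅pderiv (R := R) v, pderiv (R := R) w⁆ = 0 := by
    refine derivation_ext fun u => ?_
    simp only [Derivation.commutator_apply, pderiv_X, Pi.single_apply]
    split_ifs <;> simp
  exact sub_eq_zero.1 (congrArg (fun D : Derivation R _ (MvPolynomial σ R) => D P) h)

section Operators

variable {N : ℕ} {A : Fin (N + 1) → ℂ}

theorem derivation_qv (A : Fin (N + 1) → ℂ) (D : Derivation Kε (Wt N) (Wt N))
    (v : Fin (N + 1) × ℕ) : D (qv N A v) = D (X v) := by
  simp [qv]

theorem pderiv_qv (A : Fin (N + 1) → ℂ) (v w : Fin (N + 1) × ℕ) :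
    pderiv v (qv N A w) = if w = v then 1 else 0 := by
  rw [derivation_qv, pderiv_X, Pi.single_apply]

/-- The derivation `Σ_{d≥0} q^α_{d+1} ∂/∂q^α_d`. -/
def shiftDerivation (N : ℕ) (A : Fin (N + 1) → ℂ) : Derivation Kε (Wt N) (Wt N) :=
  mkDerivation Kε fun v => qv N A (v.1, v.2 + 1)

/-- The derivation `Σ_{i≥1, j≥0} (r_i)^μ_ν q^ν_j ∂/∂q^μ_{i+j}`. -/
def linearDerivation (N : ℕ) (A : Fin (N + 1) → ℂ)
    (r : ℕ → Matrix (Fin (N + 1)) (Fin (N + 1)) ℂ) : Derivation Kε (Wt N) (Wt N) :=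
  mkDerivation Kε fun v =>
    ∑ i ∈ range v.2, ∑ ν, r (i + 1) v.1 ν • qv N A (ν, v.2 - 1 - i)

/-- The derivation `Σ_{i≥1} (−1)^i (r_i)^{N+1,ν} ∂/∂q^ν_i`. -/
def translationDerivation (N : ℕ) (η : Matrix (Fin N) (Fin N) ℂ)
    (r : ℕ → Matrix (Fin (N + 1)) (Fin (N + 1)) ℂ) : Derivation Kε (Wt N) (Wt N) :=
  mkDerivation Kε fun v =>
    if v.2 = 0 then 0 else ((-1 : ℂ) ^ v.2 * rUp N η r v.2 (Fin.last N) v.1) • 1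

/-- The multiplication part of `L^{η,A}_{−1}`. -/
def quadraticPart (N : ℕ) (η : Matrix (Fin N) (Fin N) ℂ) (A : Fin (N + 1) → ℂ) : Wt N :=
  ((LaurentPolynomial.T (-2) : Kε) • ((1 / 2 : ℂ) •
      (∑ α : Fin N, ∑ β : Fin N,
        η α β • (qv N A (α.castSucc, 0) * qv N A (β.castSucc, 0))))) +
  ((LaurentPolynomial.T (-1) : Kε) • qv N A (Fin.last N, 0))

/-- The truncation `Σ_{i,j<m} (−1)^j (r_{i+j+1})^{αβ} ∂²/∂q^α_i ∂q^β_j`. -/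
def secondOrderPart (N : ℕ) (η : Matrix (Fin N) (Fin N) ℂ)
    (r : ℕ → Matrix (Fin (N + 1)) (Fin (N + 1)) ℂ) (m : ℕ) (P : Wt N) : Wt N :=
  ∑ i ∈ range m, ∑ j ∈ range m, ∑ α : Fin (N + 1), ∑ β : Fin (N + 1),
    ((-1 : ℂ) ^ j * rUp N η r (i + j + 1) α β) • pderiv (α, i) (pderiv (β, j) P)

variable {η : Matrix (Fin N) (Fin N) ℂ} {r : ℕ → Matrix (Fin (N + 1)) (Fin (N + 1)) ℂ}

theorem rUp_castSucc (i : ℕ) (α : Fin (N + 1)) (β : Fin N) :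
    rUp N η r i α β.castSucc = ∑ μ : Fin N, r i α μ.castSucc * η⁻¹ μ β := by
  simp [rUp]

theorem rUp_last_castSucc (i : ℕ) (β : Fin N) :
    rUp N η r i (Fin.last N) β.castSucc = rTop N η r i β := by
  simp [rUp, rTop]

theorem rUp_castSucc_last (i : ℕ) (α : Fin N) :
    rUp N η r i α.castSucc (Fin.last N) = (-1) ^ (i + 1) * rTop N η r i α := by
  simp [rUp]

theorem rUp_last_last (i : ℕ) : rUp N η r i (Fin.last N) (Fin.last N) = 0 := by
  simp [rUp]

theorem sum_rUp_mul (hinv : IsUnit η.det) (i : ℕ) (α : Fin (N + 1)) (γ : Fin N) :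
    ∑ β : Fin N, rUp N η r i α β.castSucc * η β γ = r i α γ.castSucc := by
  have h := Matrix.nonsing_inv_mul η hinv
  have h' : ∀ μ, ∑ β, η⁻¹ μ β * η β γ = if μ = γ then 1 else 0 := fun μ => by
    rw [← Matrix.mul_apply, h, Matrix.one_apply]
  simp_rw [rUp_castSucc, sum_mul]
  rw [sum_comm]
  simp_rw [mul_assoc, ← mul_sum, h']
  simp

theorem rUp_symm (hsym : η.IsSymm) (hinv : IsUnit η.det) (hr : memGoPlus N η r)
    (i : ℕ) (hi : 1 ≤ i) (α β : Fin (N + 1)) :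
    rUp N η r i β α = (-1) ^ (i + 1) * rUp N η r i α β := by
  have hs : ((-1 : ℂ) ^ (i + 1)) * (-1) ^ (i + 1) = 1 := by
    rw [← mul_pow]; simp
  induction α using Fin.lastCases with
  | last =>
    induction β using Fin.lastCases with
    | last => simp [rUp_last_last]
    | cast β => rw [rUp_last_castSucc, rUp_castSucc_last]
  | cast α =>
    induction β using Fin.lastCases with
    | last => rw [rUp_last_castSucc, rUp_castSucc_last, ← mul_assoc, hs, one_mul]
    | cast β =>
      set B : Matrix (Fin N) (Fin N) ℂ := Matrix.of fun a b => r i a.castSucc b.castSucc with hB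
      have h1 : η⁻¹ * B.transpose * η = (-1 : ℂ) ^ (i + 1) • B := by
        ext a b
        rw [Matrix.smul_apply, smul_eq_mul]
        refine Eq.trans ?_ (hr.2.2 i hi a b)
        simp_rw [Matrix.mul_apply, sum_mul]
        rw [sum_comm]
        rfl
      have h2 : (B * η⁻¹).transpose = (-1 : ℂ) ^ (i + 1) • (B * η⁻¹) := by
        rw [← Matrix.smul_mul, ← h1, Matrix.mul_assoc, Matrix.mul_nonsing_inv η hinv,
          Matrix.mul_one, Matrix.transpose_mul, Matrix.transpose_nonsing_inv, hsym.eq]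
      have h3 : ∀ a b : Fin N, rUp N η r i a.castSucc b.castSucc = (B * η⁻¹) a b := fun a b => by
        rw [rUp_castSucc, Matrix.mul_apply]; rfl
      rw [h3, h3]
      exact congrFun (congrFun h2 α) β

theorem finsum_eq_shiftDerivation (P : Wt N) :
    ∑ᶠ d : ℕ, ∑ α : Fin (N + 1), qv N A (α, d + 1) * pderiv (α, d) P =
      shiftDerivation N A P := by
  obtain ⟨n, hn⟩ := P.exists_forall_mem_vars_snd_lt
  rw [finsum_nat_eq_sum_range (n := n)]
  · trans (∑ d ∈ range n, ∑ α : Fin (N + 1), qv N A (α, d + 1) • pderiv (R := Kε) (α, d)) P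
    · simp [Derivation.finset_sum_apply]
    · refine derivation_eq_of_forall_mem_vars fun v hv => ?_
      obtain ⟨a, k⟩ := v
      have := hn _ hv
      simp_all [Derivation.finset_sum_apply, shiftDerivation, Pi.single_apply, Prod.ext_iff, ite_and]
  · intro d hd
    refine sum_eq_zero fun α _ => ?_
    rw [pderiv_eq_zero_of_notMem_vars fun h => (hn _ h).not_ge hd, mul_zero]

theorem finsum_eq_linearDerivation (P : Wt N) :
    ∑ᶠ i : ℕ, ∑ᶠ j : ℕ, ∑ μ : Fin (N + 1), ∑ ν : Fin (N + 1),
      r (i + 1) μ ν • (qv N A (ν, j) * pderiv (μ, i + 1 + j) P) = linearDerivation N A r P := by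
  obtain ⟨n, hn⟩ := P.exists_forall_mem_vars_snd_lt
  rw [finsum_finsum_nat_eq_sum_range (n := n)]
  · trans (∑ i ∈ range n, ∑ j ∈ range n, ∑ μ : Fin (N + 1), ∑ ν : Fin (N + 1),
        (r (i + 1) μ ν • qv N A (ν, j)) • pderiv (R := Kε) (μ, i + 1 + j)) P
    · simp [Derivation.finset_sum_apply]
    · refine derivation_eq_of_forall_mem_vars fun v hv => ?_
      obtain ⟨a, k⟩ := v
      have hk : k < n := hn _ hv
      have key : ∀ i j, (∑ μ : Fin (N + 1), ∑ ν : Fin (N + 1),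
          (r (i + 1) μ ν • qv N A (ν, j)) • pderiv (R := Kε) (μ, i + 1 + j)) (X (a, k)) =
          if i + 1 + j = k then ∑ ν, r (i + 1) a ν • qv N A (ν, j) else 0 := by
        intro i j
        by_cases h : i + 1 + j = k
        · subst h
          simp [Derivation.finset_sum_apply, Pi.single_apply, Prod.ext_iff]
        · simp [Derivation.finset_sum_apply, Prod.ext_iff, h, Ne.symm h]
      rw [Derivation.finset_sum_apply]
      simp_rw [Derivation.finset_sum_apply (range n), key]
      rw [linearDerivation, mkDerivation_X]
      refine (sum_subset_zero_on_sdiff (range_subset_range.2 hk.le) ?_ ?_).symm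
      · intro i hi
        refine sum_eq_zero fun j _ => if_neg ?_
        simp at hi
        omega
      · intro i hi
        have hi' : i < k := by simpa using hi
        rw [sum_eq_single (k - 1 - i)]
        · rw [if_pos (by omega)]
        · intro j _ hj
          exact if_neg (by omega)
        · intro h
          simp at h
          omega
  · intro i j hij
    refine sum_eq_zero fun μ _ => sum_eq_zero fun ν _ => ?_
    rw [pderiv_eq_zero_of_notMem_vars fun h => ?_, mul_zero, smul_zero]
    have : i + 1 + j < n := hn _ h
    omega

theorem finsum_eq_translationDerivation (P : Wt N) :
    ∑ᶠ i : ℕ, ∑ ν : Fin N,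
        ((-1 : ℂ) ^ (i + 1) * rTop N η r (i + 1) ν) • pderiv (ν.castSucc, i + 1) P =
      translationDerivation N η r P := by
  obtain ⟨n, hn⟩ := P.exists_forall_mem_vars_snd_lt
  have h0 : ∀ i, ∑ ν : Fin N,
        ((-1 : ℂ) ^ (i + 1) * rTop N η r (i + 1) ν) • pderiv (ν.castSucc, i + 1) P =
      ∑ ν : Fin (N + 1), (((-1 : ℂ) ^ (i + 1) * rUp N η r (i + 1) (Fin.last N) ν) • (1 : Wt N)) *
        pderiv (ν, i + 1) P := by
    intro i
    simp [Fin.sum_univ_castSucc, rUp_last_castSucc, rUp_last_last]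
  simp_rw [h0]
  rw [finsum_nat_eq_sum_range (n := n)]
  · trans (∑ i ∈ range n, ∑ ν : Fin (N + 1),
        (((-1 : ℂ) ^ (i + 1) * rUp N η r (i + 1) (Fin.last N) ν) • (1 : Wt N)) •
          pderiv (R := Kε) (ν, i + 1)) P
    · simp only [Derivation.finset_sum_apply, Derivation.smul_apply, smul_eq_mul]
    · refine derivation_eq_of_forall_mem_vars fun v hv => ?_
      obtain ⟨a, k⟩ := v
      have hk : k < n := hn _ hv
      simp only [Derivation.finset_sum_apply, Derivation.smul_apply, smul_eq_mul,
        pderiv_X, Pi.single_apply, Prod.mk.injEq, translationDerivation, mkDerivation_X,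
        ite_and, mul_ite, mul_zero, mul_one, sum_ite_eq, mem_univ, if_true]
      cases k with
      | zero => simp
      | succ k => simp [(Nat.lt_of_succ_lt hk)]
  · intro d hd
    refine sum_eq_zero fun α _ => ?_
    rw [pderiv_eq_zero_of_notMem_vars fun h => ?_, mul_zero]
    have : d + 1 < n := hn _ h
    omega

theorem Lm1_eq (P : Wt N) :
    Lm1 N η A P = quadraticPart N η A * P + shiftDerivation N A P := by
  rw [Lm1, finsum_eq_shiftDerivation, quadraticPart, add_mul]

theorem hatRo_eq {P : Wt N} {m : ℕ} (hP : ∀ α d, m ≤ d → pderiv (α, d) P = 0) :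
    hatRo N η A r P = -linearDerivation N A r P +
      (LaurentPolynomial.T 1 : Kε) • translationDerivation N η r P +
      (1 / 2 : ℂ) • ((LaurentPolynomial.T 2 : Kε) • secondOrderPart N η r m P) := by
  rw [hatRo, finsum_eq_linearDerivation, finsum_eq_translationDerivation,
    finsum_finsum_nat_eq_sum_range (n := m), secondOrderPart]
  intro i j hij
  refine sum_eq_zero fun α _ => sum_eq_zero fun β _ => ?_
  rcases hij with hi | hj
  · rw [pderiv_comm, hP _ _ hi, map_zero, smul_zero]
  · rw [hP _ _ hj, map_zero, smul_zero]

/-- The commutator of `linearDerivation` with `shiftDerivation`. -/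
def linearRemainder (N : ℕ) (A : Fin (N + 1) → ℂ)
    (r : ℕ → Matrix (Fin (N + 1)) (Fin (N + 1)) ℂ) : Derivation Kε (Wt N) (Wt N) :=
  mkDerivation Kε fun v => ∑ ν, r (v.2 + 1) v.1 ν • qv N A (ν, 0)

/-- The commutator of `translationDerivation` with `shiftDerivation`. -/
def translationRemainder (N : ℕ) (η : Matrix (Fin N) (Fin N) ℂ)
    (r : ℕ → Matrix (Fin (N + 1)) (Fin (N + 1)) ℂ) : Derivation Kε (Wt N) (Wt N) :=
  mkDerivation Kε fun v =>
    ((-1 : ℂ) ^ (v.2 + 1) * rUp N η r (v.2 + 1) (Fin.last N) v.1) • 1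

theorem lie_linearDerivation_shiftDerivation :
    ⁅linearDerivation N A r, shiftDerivation N A⁆ = linearRemainder N A r := by
  refine derivation_ext fun v => ?_
  obtain ⟨a, k⟩ := v
  rw [Derivation.commutator_apply]
  simp only [shiftDerivation, mkDerivation_X, linearDerivation, linearRemainder, derivation_qv,
    map_sum, Derivation.map_smul_of_tower]
  rw [sum_range_succ, sub_eq_iff_eq_add', Nat.add_sub_cancel, Nat.sub_self]
  refine congrArg (· + _) (sum_congr rfl fun i hi => sum_congr rfl fun ν _ => ?_)
  rw [show k - i = k - 1 - i + 1 by have := mem_range.1 hi; omega]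

theorem lie_translationDerivation_shiftDerivation :
    ⁅translationDerivation N η r, shiftDerivation N A⁆ = translationRemainder N η r := by
  refine derivation_ext fun v => ?_
  obtain ⟨a, k⟩ := v
  rw [Derivation.commutator_apply]
  simp only [shiftDerivation, mkDerivation_X, translationDerivation, translationRemainder,
    derivation_qv]
  split_ifs <;> simp_all [Derivation.map_smul_of_tower]

theorem pderiv_zero_shiftDerivation (α : Fin (N + 1)) (P : Wt N) :
    pderiv (α, 0) (shiftDerivation N A P) = shiftDerivation N A (pderiv (α, 0) P) := by
  have h : ⁅pderiv (R := Kε) (α, 0), shiftDerivation N A⁆ = 0 := by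
    refine derivation_ext fun v => ?_
    simp only [Derivation.commutator_apply, pderiv_X, Pi.single_apply, shiftDerivation,
      mkDerivation_X, pderiv_qv]
    split_ifs <;> simp_all
  exact sub_eq_zero.1 (congrArg (fun D : Derivation Kε (Wt N) (Wt N) => D P) h)

theorem pderiv_succ_shiftDerivation (α : Fin (N + 1)) (d : ℕ) (P : Wt N) :
    pderiv (α, d + 1) (shiftDerivation N A P) =
      shiftDerivation N A (pderiv (α, d + 1) P) + pderiv (α, d) P := by
  have h : ⁅pderiv (R := Kε) (α, d + 1), shiftDerivation N A⁆ = pderiv (α, d) := by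
    refine derivation_ext fun v => ?_
    obtain ⟨b, k⟩ := v
    simp only [Derivation.commutator_apply, pderiv_X, Pi.single_apply, shiftDerivation,
      mkDerivation_X, pderiv_qv, Prod.mk.injEq, add_left_inj]
    split_ifs <;> simp
  exact sub_eq_iff_eq_add'.1 (congrArg (fun D : Derivation Kε (Wt N) (Wt N) => D P) h)

/-- The derivative of `quadraticPart` with respect to `q^α_0`. -/
def quadraticGrad (N : ℕ) (η : Matrix (Fin N) (Fin N) ℂ) (A : Fin (N + 1) → ℂ)
    (α : Fin (N + 1)) : Wt N :=
  Fin.lastCases (motive := fun _ => Wt N) ((LaurentPolynomial.T (-1) : Kε) • 1)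
    (fun α => (LaurentPolynomial.T (-2) : Kε) • ∑ γ, η α γ • qv N A (γ.castSucc, 0)) α

theorem pderiv_succ_quadraticPart (α : Fin (N + 1)) (d : ℕ) :
    pderiv (α, d + 1) (quadraticPart N η A) = 0 := by
  simp [quadraticPart, Derivation.map_smul_of_tower, pderiv_qv, Derivation.leibniz]

theorem pderiv_zero_quadraticPart (hsym : η.IsSymm) (α : Fin (N + 1)) :
    pderiv (α, 0) (quadraticPart N η A) = quadraticGrad N η A α := by
  induction α using Fin.lastCases with
  | last =>
    simp [quadraticPart, quadraticGrad, Derivation.map_smul_of_tower, pderiv_qv,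
      Derivation.leibniz, Fin.castSucc_ne_last]
  | cast α =>
    have h : ∑ x, η x α • qv N A (x.castSucc, 0) = ∑ x, η α x • qv N A (x.castSucc, 0) :=
      sum_congr rfl fun x _ => by rw [hsym.apply]
    simp only [quadraticPart, quadraticGrad, map_add, Derivation.map_smul, map_sum,
      Derivation.map_smul_of_tower, pderiv_qv, Derivation.leibniz, Prod.mk.injEq,
      Fin.castSucc_inj, and_true, (Fin.castSucc_ne_last _).symm, Fin.lastCases_castSucc, smul_eq_mul,
      mul_ite, mul_one, mul_zero, smul_add, smul_ite, smul_zero, sum_add_distrib, sum_ite_eq',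
      mem_univ, if_true, if_false, add_zero]
    rw [sum_comm]
    simp only [sum_ite_eq', mem_univ, if_true, h]
    rw [← smul_add, ← smul_add, ← two_smul ℂ, smul_smul]
    norm_num

theorem secondOrderPart_shiftDerivation {P : Wt N} {m : ℕ}
    (hP : ∀ α d, m ≤ d → pderiv (α, d) P = 0) :
    secondOrderPart N η r (m + 1) (shiftDerivation N A P) =
      shiftDerivation N A (secondOrderPart N η r (m + 1) P) := by
  set c : ℕ → ℕ → Fin (N + 1) → Fin (N + 1) → ℂ :=
    fun i j α β => (-1 : ℂ) ^ j * rUp N η r (i + j + 1) α β with hc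
  have h (i j α β) : pderiv (α, i) (pderiv (β, j) (shiftDerivation N A P)) =
      shiftDerivation N A (pderiv (α, i) (pderiv (β, j) P)) +
      ((if i = 0 then 0 else pderiv (α, i - 1) (pderiv (β, j) P)) +
        (if j = 0 then 0 else pderiv (α, i) (pderiv (β, j - 1) P))) := by
    cases i <;> cases j <;>
      simp [pderiv_zero_shiftDerivation, pderiv_succ_shiftDerivation, add_assoc]
  have h1 : ∑ i ∈ range (m + 1), ∑ j ∈ range (m + 1), ∑ α, ∑ β,
      c i j α β • (if i = 0 then 0 else pderiv (α, i - 1) (pderiv (β, j) P)) =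
      ∑ i ∈ range m, ∑ j ∈ range m, ∑ α, ∑ β,
        c (i + 1) j α β • pderiv (α, i) (pderiv (β, j) P) := by
    rw [sum_range_succ']
    simp [sum_range_succ, hP]
  have h2 : ∑ i ∈ range (m + 1), ∑ j ∈ range (m + 1), ∑ α, ∑ β,
      c i j α β • (if j = 0 then 0 else pderiv (α, i) (pderiv (β, j - 1) P)) =
      ∑ i ∈ range m, ∑ j ∈ range m, ∑ α, ∑ β,
        c i (j + 1) α β • pderiv (α, i) (pderiv (β, j) P) := by
    rw [sum_range_succ]
    simp [sum_range_succ', pderiv_comm (_, m), hP]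
  have h3 : ∀ i j α β, c (i + 1) j α β + c i (j + 1) α β = 0 := fun i j α β => by
    simp only [hc, pow_succ, show i + 1 + j + 1 = i + (j + 1) + 1 by omega]
    ring
  simp only [secondOrderPart, h, map_sum, Derivation.map_smul_of_tower, smul_add, sum_add_distrib]
  rw [h1, h2]
  simp only [← sum_add_distrib, ← add_smul, h3]
  simp

theorem sum_quadraticGrad_mul_pderiv (hsym : η.IsSymm) (hinv : IsUnit η.det)
    (hr : memGoPlus N η r) {P : Wt N} {m : ℕ} (hP : ∀ v ∈ P.vars, v.2 < m) :
    ∑ j ∈ range m, ∑ α, ∑ β, ((-1 : ℂ) ^ j * rUp N η r (j + 1) α β) •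
        (quadraticGrad N η A α * pderiv (β, j) P) =
      (LaurentPolynomial.T (-2) : Kε) • linearRemainder N A r P -
        (LaurentPolynomial.T (-1) : Kε) • translationRemainder N η r P := by
  trans (∑ j ∈ range m, ∑ α, ∑ β, (((-1 : ℂ) ^ j * rUp N η r (j + 1) α β) •
        quadraticGrad N η A α) • pderiv (R := Kε) (β, j)) P
  · simp only [Derivation.finset_sum_apply, Derivation.smul_apply, smul_eq_mul, smul_mul_assoc]
  trans ((LaurentPolynomial.T (-2) : Kε) • linearRemainder N A r -
      (LaurentPolynomial.T (-1) : Kε) • translationRemainder N η r) P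
  swap
  · rfl
  refine derivation_eq_of_forall_mem_vars fun v hv => ?_
  obtain ⟨b, k⟩ := v
  have hk : k < m := hP _ hv
  have hs (α : Fin (N + 1)) : (-1 : ℂ) ^ k * rUp N η r (k + 1) α b = rUp N η r (k + 1) b α := by
    rw [rUp_symm hsym hinv hr (k + 1) (by omega) α b, pow_add, pow_add]
    ring
  trans ∑ α, ((-1 : ℂ) ^ k * rUp N η r (k + 1) α b) • quadraticGrad N η A α
  · simp only [Derivation.finset_sum_apply, Derivation.smul_apply, smul_eq_mul, pderiv_X,
      Pi.single_apply, Prod.mk.injEq, ite_and, mul_ite, mul_one, mul_zero, sum_ite_eq, mem_univ,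
      if_true]
    rw [sum_eq_single k]
    · simp
    · intro j _ hj
      simp [hj.symm]
    · simp [hk]
  · rw [Derivation.sub_apply, Derivation.smul_apply, Derivation.smul_apply, linearRemainder,
      translationRemainder, mkDerivation_X, mkDerivation_X, Fin.sum_univ_castSucc,
      Fin.sum_univ_castSucc, sub_eq_add_neg]
    congr 1
    · simp only [hs, quadraticGrad, Fin.lastCases_castSucc, hr.2.1, zero_smul, add_zero]
      simp only [← sum_rUp_mul hinv, smul_comm (_ : ℂ) (_ : Kε), ← smul_sum]
      simp only [smul_sum, sum_smul, smul_smul]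
      rw [sum_comm]
    · simp only [quadraticGrad, Fin.lastCases_last]
      rw [smul_comm, ← smul_neg, ← neg_smul, pow_succ]
      simp

theorem sum_rUp_smul_pderiv_quadraticGrad (hinv : IsUnit η.det)
    (hr : memGoPlus N η r) :
    ∑ α, ∑ β, rUp N η r 1 α β • pderiv (α, 0) (quadraticGrad N η A β) =
      (LaurentPolynomial.T (-2) : Kε) • Matrix.trace (r 1) • (1 : Wt N) := by
  have h1 : ∀ α, pderiv (α, 0) (quadraticGrad N η A (Fin.last N)) = 0 := by
    simp [quadraticGrad]
  have h2 : ∀ β : Fin N, pderiv (Fin.last N, 0) (quadraticGrad N η A β.castSucc) = 0 := by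
    simp [quadraticGrad, Derivation.map_smul_of_tower, pderiv_qv, Fin.castSucc_ne_last]
  have h3 : ∀ α β : Fin N, pderiv (α.castSucc, 0) (quadraticGrad N η A β.castSucc) =
      (LaurentPolynomial.T (-2) : Kε) • η β α • (1 : Wt N) := by
    simp [quadraticGrad, Derivation.map_smul_of_tower, pderiv_qv]
  simp only [Fin.sum_univ_castSucc, h1, h2, h3, smul_zero, add_zero, sum_const_zero, Matrix.trace,
    Matrix.diag, hr.2.1, ← sum_rUp_mul hinv, smul_comm (_ : ℂ) (_ : Kε), ← smul_sum, smul_smul,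
    ← sum_smul]

theorem pderiv_quadraticGrad_succ (α β : Fin (N + 1)) (d : ℕ) :
    pderiv (α, d + 1) (quadraticGrad N η A β) = 0 := by
  induction β using Fin.lastCases with
  | last => simp [quadraticGrad]
  | cast β => simp [quadraticGrad, Derivation.map_smul_of_tower, pderiv_qv]

theorem secondOrderPart_quadraticPart_mul (hsym : η.IsSymm) (hinv : IsUnit η.det)
    (hr : memGoPlus N η r) {P : Wt N} {m : ℕ} (hP : ∀ v ∈ P.vars, v.2 < m + 1) :
    secondOrderPart N η r (m + 1) (quadraticPart N η A * P) =
      quadraticPart N η A * secondOrderPart N η r (m + 1) P +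
      (LaurentPolynomial.T (-2) : Kε) • Matrix.trace (r 1) • P +
      (2 : ℂ) • ((LaurentPolynomial.T (-2) : Kε) • linearRemainder N A r P -
        (LaurentPolynomial.T (-1) : Kε) • translationRemainder N η r P) := by
  set F := quadraticPart N η A with hF
  set c : ℕ → ℕ → Fin (N + 1) → Fin (N + 1) → ℂ :=
    fun i j α β => (-1 : ℂ) ^ j * rUp N η r (i + j + 1) α β with hc
  have hsymm : ∀ i j α β, c i j α β = c j i β α := fun i j α β => by
    simp only [hc]
    rw [rUp_symm hsym hinv hr (i + j + 1) (by omega) β α, show j + i + 1 = i + j + 1 by omega,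
      show i + j + 1 + 1 = i + j + 2 by omega, ← mul_assoc]
    congr 1
    rw [← pow_add, show j + (i + j + 2) = 2 * (j + 1) + i by ring, pow_add, pow_mul]
    simp
  have hL (i j α β) : pderiv (α, i) (pderiv (β, j) (F * P)) =
      F * pderiv (α, i) (pderiv (β, j) P) + pderiv (α, i) (pderiv (β, j) F) * P +
      (pderiv (α, i) F * pderiv (β, j) P + pderiv (β, j) F * pderiv (α, i) P) := by
    simp only [pderiv_mul, map_add]
    ring
  have h1 : ∑ i ∈ range (m + 1), ∑ j ∈ range (m + 1), ∑ α, ∑ β,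
      c i j α β • (pderiv (α, i) F * pderiv (β, j) P) =
      (LaurentPolynomial.T (-2) : Kε) • linearRemainder N A r P -
        (LaurentPolynomial.T (-1) : Kε) • translationRemainder N η r P := by
    rw [sum_range_succ', ← sum_quadraticGrad_mul_pderiv hsym hinv hr hP]
    simp [hF, pderiv_succ_quadraticPart, pderiv_zero_quadraticPart hsym, hc]
  have h2 : ∑ i ∈ range (m + 1), ∑ j ∈ range (m + 1), ∑ α, ∑ β,
      c i j α β • (pderiv (β, j) F * pderiv (α, i) P) =
      ∑ i ∈ range (m + 1), ∑ j ∈ range (m + 1), ∑ α, ∑ β,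
        c i j α β • (pderiv (α, i) F * pderiv (β, j) P) := by
    rw [sum_comm]
    refine sum_congr rfl fun i _ => sum_congr rfl fun j _ => ?_
    rw [sum_comm]
    refine sum_congr rfl fun α _ => sum_congr rfl fun β _ => ?_
    rw [hsymm]
  have h3 : ∑ i ∈ range (m + 1), ∑ j ∈ range (m + 1), ∑ α, ∑ β,
      c i j α β • (pderiv (α, i) (pderiv (β, j) F) * P) =
      (LaurentPolynomial.T (-2) : Kε) • Matrix.trace (r 1) • P := by
    have h := congrArg (· * P) (sum_rUp_smul_pderiv_quadraticGrad (A := A) hinv hr)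
    simp only [smul_mul_assoc, one_mul, sum_mul] at h
    rw [← h, sum_range_succ']
    simp [sum_range_succ', hF, pderiv_succ_quadraticPart, pderiv_zero_quadraticPart hsym, hc,
      pderiv_quadraticGrad_succ]
  simp only [secondOrderPart, hL, smul_add, sum_add_distrib, mul_sum, mul_smul_comm]
  rw [h1, h2, h1, h3, two_smul]

end Operators

/-- `[r̂^o, L^{η,A}_{−1}] = (1/2) tr(r_1) · Id`. -/
theorem commutator_hatRo_Lm1 (N : ℕ) (hN : 1 ≤ N)
    (η : Matrix (Fin N) (Fin N) ℂ) (hsym : η.IsSymm) (hinv : IsUnit η.det)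
    (A : Fin (N + 1) → ℂ)
    (r : ℕ → Matrix (Fin (N + 1)) (Fin (N + 1)) ℂ) (hr : memGoPlus N η r) :
    ∀ P : Wt N,
      hatRo N η A r (Lm1 N η A P) - Lm1 N η A (hatRo N η A r P) =
        ((1 / 2 : ℂ) * Matrix.trace (r 1)) • P := by
  intro P
  obtain ⟨m, hm⟩ := P.exists_forall_mem_vars_snd_lt
  have hP : ∀ α d, m ≤ d → pderiv (α, d) P = 0 := fun α d hd =>
    pderiv_eq_zero_of_notMem_vars fun h => (hm _ h).not_ge hd
  have hLP : ∀ α d, m + 1 ≤ d → pderiv (α, d) (Lm1 N η A P) = 0 := by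
    intro α d hd
    obtain ⟨d, rfl⟩ : ∃ e, d = e + 1 := ⟨d - 1, by omega⟩
    rw [Lm1_eq, map_add, pderiv_mul, pderiv_succ_quadraticPart, pderiv_succ_shiftDerivation,
      hP _ _ (by omega), hP _ _ (by omega)]
    simp
  have hR : linearDerivation N A r (quadraticPart N η A) = 0 := by
    simp [quadraticPart, Derivation.map_smul_of_tower, derivation_qv, Derivation.leibniz,
      linearDerivation]
  have hS : translationDerivation N η r (quadraticPart N η A) = 0 := by
    simp [quadraticPart, Derivation.map_smul_of_tower, derivation_qv, Derivation.leibniz,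
      translationDerivation]
  have hRD := congrArg (fun D : Derivation Kε (Wt N) (Wt N) => D P)
    (lie_linearDerivation_shiftDerivation (A := A) (r := r))
  have hSD := congrArg (fun D : Derivation Kε (Wt N) (Wt N) => D P)
    (lie_translationDerivation_shiftDerivation (A := A) (η := η) (r := r))
  simp only [Derivation.commutator_apply, sub_eq_iff_eq_add] at hRD hSD
  have hT : ∀ Q Q', secondOrderPart N η r (m + 1) (Q + Q') =
      secondOrderPart N η r (m + 1) Q + secondOrderPart N η r (m + 1) Q' := fun Q Q' => by
    simp only [secondOrderPart, map_add, smul_add, sum_add_distrib]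
  have hneg : ∀ a b : Wt N, a * -b = -(a * b) := fun a b => by ring
  rw [hatRo_eq hLP, hatRo_eq (m := m + 1) fun α d hd => hP α d (by omega), Lm1_eq, Lm1_eq, hT,
    secondOrderPart_shiftDerivation hP, secondOrderPart_quadraticPart_mul hsym hinv hr
      fun v hv => (hm v hv).trans (Nat.lt_succ_self m)]
  simp only [map_add, map_neg, Derivation.map_smul, Derivation.map_smul_of_tower,
    Derivation.leibniz, hR, hS, hRD, hSD, smul_eq_mul, mul_zero, add_zero, mul_add,
    mul_smul_comm, smul_add, smul_sub, smul_comm (_ : ℂ) (_ : Kε)]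
  simp only [smul_smul, ← LaurentPolynomial.T_add]
  norm_num
  rw [hneg]
  module
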